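/- Let $n \ge 2$, let $X$ be a metric space with distance $\operatorname{dist}$, and let $v_1,\dots,v_n \in X$ be pairwise distinct, regarded as the vertices of a path $P$ in which the edge joining $v_m$ and $v_{m+1}$ has length $\operatorname{dist}(v_m,v_{m+1})$. For $a,b\in\{1,\dots,n\}$ let $d_P(a,b)=\sum_{m=\min(a,b)}^{\max(a,b)-1}\operatorname{dist}(v_m,v_{m+1})$. For $1\le i\le j\le n$ let $G(i,j)$ be $P$ together with an additional edge joining $v_i$ and $v_j$ of length $\operatorname{dist}(v_i,v_j)$, with shortest-path distance $$d_{G(i,j)}(a,b)=\min\bigl\{d_P(a,b),\ d_P(a,i)+\operatorname{dist}(v_i,v_j)+d_P(j,b),\ d_P(a,j)+\operatorname{dist}(v_i,v_j)+d_P(i,b)\bigr\}.$$ Put $\operatorname{ecc}(i,j,c)=\max_{1\le k\le n}d_{G(i,j)}(c,k)$, $\operatorname{rad}(i,j)=\min_{1\le c\le n}\operatorname{ecc}(i,j,c)$ and $r^*=\min_{1\le i\le j\le n}\operatorname{rad}(i,j)$. The pair $(i,j)$ is an optimal solution if $\operatorname{rad}(i,j)=r^*$, and $v_c$ is a center of $G(i,j)$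 if $\operatorname{ecc}(i,j,c)=\operatorname{rad}(i,j)$. Let $1\le i<c<j\le n$ and let $r=\operatorname{ecc}(i,j,c)$. Suppose that $d_{G(i,j)}(c,1)=r$ and $r=d_P(1,c)$ (that is, $v_1$ is a farthest vertex from $v_c$ in $G(i,j)$ and the subpath of $P$ from $v_c$ to $v_1$ is a shortest path in $G(i,j)$). Then $d_{G(c,j)}(c,k)\le r$ for every $k$ with $1\le k\le n$; consequently $\operatorname{ecc}(c,j,c)\le r$. If, additionally, $(i,j)$ is an optimal solution and $v_c$ is a center of $G(i,j)$ (so that $r=\operatorname{rad}(i,j)=r^*$), then $(c,j)$ is an optimal solution and $v_c$ is a center of $G(c,j)$. -/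

import Mathlib

/-- Path distance along `P` between the vertices with indices `a` and `b`. The vertices are
`v 1, …, v n`; for `a, b ∈ [1, n]` no other value of `v` enters. -/
noncomputable def dP {X : Type*} [MetricSpace X] (v : ℕ → X) (a b : ℕ) : ℝ :=
  ∑ m ∈ Finset.Ico (min a b) (max a b), dist (v m) (v (m + 1))

/-- Shortest-path distance in the augmented graph `G(i,j)`. -/
noncomputable def dG {X : Type*} [MetricSpace X] (v : ℕ → X) (i j a b : ℕ) : ℝ :=
  min (dP v a b)
    (min (dP v a i + dist (v i) (v j) + dP v j b)
         (dP v a j + dist (v i) (v j) + dP v i b))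

/-- Eccentricity of the vertex `c` in `G(i,j)`: the maximum of `dG v i j c k` over `1 ≤ k ≤ n`
(a finite set, nonempty for `1 ≤ n`). -/
noncomputable def ecc {X : Type*} [MetricSpace X] (v : ℕ → X) (n i j c : ℕ) : ℝ :=
  sSup ((fun k => dG v i j c k) '' Set.Icc 1 n)

/-- Radius of `G(i,j)`: the minimum of the eccentricities over `1 ≤ c ≤ n`. -/
noncomputable def rad {X : Type*} [MetricSpace X] (v : ℕ → X) (n i j : ℕ) : ℝ :=
  sInf ((fun c => ecc v n i j c) '' Set.Icc 1 n)

/-- Optimal radius: the minimum of `rad v n i j` over `1 ≤ i ≤ j ≤ n`. -/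
noncomputable def rstar {X : Type*} [MetricSpace X] (v : ℕ → X) (n : ℕ) : ℝ :=
  sInf {x | ∃ i j : ℕ, 1 ≤ i ∧ i ≤ j ∧ j ≤ n ∧ x = rad v n i j}

/-- The index pair `(i,j)` is an optimal solution. -/
def IsOptimalPair {X : Type*} [MetricSpace X] (v : ℕ → X) (n i j : ℕ) : Prop :=
  1 ≤ i ∧ i ≤ j ∧ j ≤ n ∧ rad v n i j = rstar v n

/-- The vertex with index `c` is a center of `G(i,j)`. -/
def IsCenter {X : Type*} [MetricSpace X] (v : ℕ → X) (n i j c : ℕ) : Prop :=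
  1 ≤ c ∧ c ≤ n ∧ ecc v n i j c = rad v n i j

section PathDistance

variable {X : Type*} [MetricSpace X] (v : ℕ → X)

theorem dP_nonneg (a b : ℕ) : 0 ≤ dP v a b :=
  Finset.sum_nonneg fun _ _ => dist_nonneg

theorem dP_comm (a b : ℕ) : dP v a b = dP v b a := by
  simp only [dP, min_comm a b, max_comm a b]

theorem dP_self (a : ℕ) : dP v a a = 0 := by
  simp [dP]

/-- Path distance is monotone under inclusion of the spanned index intervals. -/
theorem dP_mono {a b a' b' : ℕ} (hmin : min a' b' ≤ min a b) (hmax : max a b ≤ max a' b') :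
    dP v a b ≤ dP v a' b' :=
  Finset.sum_le_sum_of_subset_of_nonneg (Finset.Ico_subset_Ico hmin hmax)
    fun _ _ _ => dist_nonneg

theorem dist_le_dP (a b : ℕ) : dist (v a) (v b) ≤ dP v a b := by
  wlog h : a ≤ b generalizing a b
  · rw [dist_comm, dP_comm]
    exact this b a (le_of_not_ge h)
  · rw [dP, min_eq_left h, max_eq_right h]
    exact dist_le_Ico_sum_dist v h

theorem dG_nonneg (i j a b : ℕ) : 0 ≤ dG v i j a b := by
  have h (x y z w : ℕ) : 0 ≤ dP v x y + dist (v i) (v j) + dP v z w :=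
    add_nonneg (add_nonneg (dP_nonneg v _ _) dist_nonneg) (dP_nonneg v _ _)
  exact le_min (dP_nonneg v _ _) (le_min (h _ _ _ _) (h _ _ _ _))

theorem dG_le_dP (i j a b : ℕ) : dG v i j a b ≤ dP v a b :=
  min_le_left _ _

theorem dG_le_dist_add_dP (c j k : ℕ) : dG v c j c k ≤ dist (v c) (v j) + dP v j k := by
  have h : dG v c j c k ≤ dP v c c + dist (v c) (v j) + dP v j k :=
    (min_le_right _ _).trans (min_le_left _ _)
  rwa [dP_self, zero_add] at h

/-- Moving the left endpoint of the extra edge to `c` does not increase the distances from `c`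
to the vertices on the right of `c`. -/
theorem dG_shortcut_le {i c j k : ℕ} (hic : i ≤ c) (hck : c ≤ k) :
    dG v c j c k ≤ dG v i j c k := by
  refine le_min (dG_le_dP v _ _ _ _) (le_min ?_ ?_)
  · refine (dG_le_dist_add_dP v c j k).trans (add_le_add_left ?_ _)
    exact (dist_triangle _ (v i) _).trans (add_le_add_left (dist_le_dP v c i) _)
  · have hmono : dP v c k ≤ dP v i k := dP_mono v (by omega) (by omega)
    have hle := dG_le_dP v c j c k
    have hcj := dP_nonneg v c j
    have hij : 0 ≤ dist (v i) (v j) := dist_nonneg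
    linarith

theorem dG_le_ecc {n k : ℕ} (i j c : ℕ) (hk : k ∈ Set.Icc 1 n) :
    dG v i j c k ≤ ecc v n i j c :=
  le_csSup ((Set.finite_Icc 1 n).image _).bddAbove (Set.mem_image_of_mem _ hk)

theorem ecc_nonneg (n i j c : ℕ) : 0 ≤ ecc v n i j c := by
  apply Real.sSup_nonneg
  rintro _ ⟨k, -, rfl⟩
  exact dG_nonneg v i j c k

theorem ecc_le {n i j c : ℕ} {r : ℝ} (hn : 1 ≤ n)
    (h : ∀ k, 1 ≤ k → k ≤ n → dG v i j c k ≤ r) : ecc v n i j c ≤ r := by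
  refine csSup_le ((Set.nonempty_Icc.2 hn).image _) ?_
  rintro _ ⟨k, hk, rfl⟩
  exact h k hk.1 hk.2

theorem rad_nonneg (n i j : ℕ) : 0 ≤ rad v n i j := by
  apply Real.sInf_nonneg
  rintro _ ⟨c, -, rfl⟩
  exact ecc_nonneg v n i j c

theorem rad_le_ecc {n c : ℕ} (i j : ℕ) (hc : c ∈ Set.Icc 1 n) :
    rad v n i j ≤ ecc v n i j c :=
  csInf_le ((Set.finite_Icc 1 n).image _).bddBelow (Set.mem_image_of_mem _ hc)

theorem rstar_le_rad {n i j : ℕ} (hi : 1 ≤ i) (hij : i ≤ j) (hj : j ≤ n) :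
    rstar v n ≤ rad v n i j := by
  refine csInf_le ⟨0, ?_⟩ ⟨i, j, hi, hij, hj, rfl⟩
  rintro _ ⟨i', j', -, -, -, rfl⟩
  exact rad_nonneg v n i' j'

end PathDistance

theorem stmt_11 {X : Type*} [MetricSpace X] (n : ℕ) (hn : 2 ≤ n) (v : ℕ → X)
    (hv : Set.InjOn v (Set.Icc 1 n))
    (i c j : ℕ) (hi : 1 ≤ i) (hic : i < c) (hcj : c < j) (hjn : j ≤ n)
    (r : ℝ) (hr : r = ecc v n i j c)
    (hfar : dG v i j c 1 = r)
    (hpath : r = dP v 1 c) :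
    (∀ k : ℕ, 1 ≤ k → k ≤ n → dG v c j c k ≤ r) ∧
    ecc v n c j c ≤ r ∧
    (IsOptimalPair v n i j → IsCenter v n i j c →
      IsOptimalPair v n c j ∧ IsCenter v n c j c) := by
  have hdist : ∀ k : ℕ, 1 ≤ k → k ≤ n → dG v c j c k ≤ r := by
    intro k hk hkn
    rcases le_total k c with hkc | hck
    · rw [hpath]
      exact (dG_le_dP v c j c k).trans (dP_mono v (by omega) (by omega))
    · rw [hr]
      exact (dG_shortcut_le v hic.le hck).trans (dG_le_ecc v i j c ⟨hk, hkn⟩)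
  have hecc : ecc v n c j c ≤ r := ecc_le v (by omega) hdist
  refine ⟨hdist, hecc, ?_⟩
  rintro ⟨-, -, -, hopt⟩ ⟨-, -, hcenter⟩
  have hc1 : 1 ≤ c := by omega
  have hcn : c ≤ n := by omega
  have hrad : rad v n c j ≤ ecc v n c j c := rad_le_ecc v c j ⟨hc1, hcn⟩
  have hstar : rstar v n ≤ rad v n c j := rstar_le_rad v hc1 hcj.le hjn
  exact ⟨⟨hc1, hcj.le, hjn, by linarith⟩, hc1, hcn, by linarith⟩
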